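/- arXiv:2504.06589 — 2 statements merged into one kernel-verified Lean document; each statement's English description precedes it below -/
import Mathlib

section
/- If a Social Welfare Function w : P̄^N → P̄ has a dictator at individual i, then in the Self-Reference System (w, Ω_i) the i-th indicator Υ_i is a diagonaliser restricted to the domain P^N: Υ_i ∗ p = p ∗ p for every p ∈ P^N. -/
/-- A weak order on `A`: a transitive and complete (total) binary relation. -/
structure WeakOrder (A : Type*) where
  rel : A → A → Prop
  trans : ∀ a b c, rel a b → rel b c → rel a c
  total : ∀ a b, rel a b ∨ rel b a

namespace WeakOrder

/-- Strict preference: `a ≺ b` in `r`. -/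
def strict {A : Type*} (r : WeakOrder A) (a b : A) : Prop := r.rel a b ∧ ¬ r.rel b a

/-- The reversed (converse) weak order. -/
def reverse {A : Type*} (r : WeakOrder A) : WeakOrder A :=
  ⟨fun a b => r.rel b a, fun a b c h1 h2 => r.trans c b a h2 h1, fun a b => r.total b a⟩

end WeakOrder

/-- The totally indifferent weak order `𝐢`. -/
def indiff (A : Type*) : WeakOrder A :=
  ⟨fun _ _ => True, fun _ _ _ _ _ => trivial, fun _ _ => Or.inl trivial⟩

/-- The strictness ordering on weak orders: `r ≤ s` iff every strict
preference of `s` is a strict preference of `r`. -/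
def strLE {A : Type*} (r s : WeakOrder A) : Prop :=
  ∀ a b, s.strict a b → r.strict a b

/-- `P̄ = P ∪ {𝐜}`, with `none` playing the role of the contradictory
preference cycle `𝐜` and `some r` the weak order `r`. -/
abbrev Pbar (A : Type*) := Option (WeakOrder A)

/-- The strictness ordering extended to `P̄`, with `𝐜 = none` as bottom. -/
def barLE {A : Type*} : Pbar A → Pbar A → Prop
  | none, _ => True
  | some _, none => False
  | some r, some s => strLE r s

/-- `t` is a greatest lower bound of `r` and `s` in `(P̄, ≤)`. -/
def IsGLBbar {A : Type*} (r s t : Pbar A) : Prop :=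
  barLE t r ∧ barLE t s ∧ ∀ u, barLE u r → barLE u s → barLE u t

/-- `t` is a least upper bound of `r` and `s` in `(P̄, ≤)`. -/
def IsLUBbar {A : Type*} (r s t : Pbar A) : Prop :=
  barLE r t ∧ barLE s t ∧ ∀ u, barLE r u → barLE s u → barLE t u

open Classical in
/-- `r ⊓ s`: the greatest lower bound of `r` and `s` in `(P̄, ≤)` (which always
exists; `𝐜` as a default value otherwise). -/
noncomputable def pinf {A : Type*} (r s : Pbar A) : Pbar A :=
  if h : ∃ t, IsGLBbar r s t then h.choose else none

/-- `t` is a least upper bound of the weak orders `r` and `s` in the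
strictness ordering on `P`. -/
def IsLUBw {A : Type*} (r s t : WeakOrder A) : Prop :=
  strLE r t ∧ strLE s t ∧ ∀ u, strLE r u → strLE s u → strLE t u

/-- `t` is a greatest lower bound of the weak orders `r` and `s` in the
strictness ordering on `P`. -/
def IsGLBw {A : Type*} (r s t : WeakOrder A) : Prop :=
  strLE t r ∧ strLE t s ∧ ∀ u, strLE u r → strLE u s → strLE u t

open Classical in
/-- `r ⊔ s`: the least upper bound of two weak orders in the strictness
ordering (which always exists; default value otherwise). -/
noncomputable def wsup {A : Type*} (r s : WeakOrder A) : WeakOrder A :=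
  if h : ∃ t, IsLUBw r s t then h.choose else indiff A

/-- The join `+ : P̄ × P̄ → P̄`: `r + s = r ⊔ s` when both are weak orders,
and `𝐢` otherwise. -/
noncomputable def pjoin {A : Type*} : Pbar A → Pbar A → Pbar A
  | some r, some s => some (wsup r s)
  | _, _ => some (indiff A)

open Classical in
/-- Negation on `P̄`: `¬𝐜 = 𝐢`, `¬𝐢 = 𝐜`, and otherwise the weak order with
all strict preferences reversed. -/
noncomputable def pneg {A : Type*} : Pbar A → Pbar A
  | none => some (indiff A)
  | some r => if r = indiff A then none else some r.reverse

/-- The inclusion `P^N ⊆ P̄^N` of profiles of weak orders. -/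
def coeP {A : Type*} {N : ℕ} (p : Fin N → WeakOrder A) : Fin N → Pbar A :=
  fun j => some (p j)

/-- `w` has a dictator at individual `i`. -/
def HasDictatorAt {A : Type*} {N : ℕ} (w : (Fin N → Pbar A) → Pbar A) (i : Fin N) : Prop :=
  ∀ p : Fin N → WeakOrder A,
    (w (coeP p) = none → p i = indiff A) ∧
    (p i ≠ indiff A → barLE (w (coeP p)) (some (p i)))

/-- The application function `Ω_i`. -/
noncomputable def Omega {A : Type*} {N : ℕ} (i : Fin N) (p : Fin N → Pbar A) (r : Pbar A) :
    Fin N → Pbar A :=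
  fun j => if j = i then pinf (p i) r else none

/-- The `i`-th indicator `Υ_i`: `𝐢` in coordinate `i` and `𝐜` elsewhere. -/
def indicator {A : Type*} {N : ℕ} (i : Fin N) : Fin N → Pbar A :=
  fun j => if j = i then some (indiff A) else none

/-- Coordinatewise negation on tuples. -/
noncomputable def negT {A : Type*} {N : ℕ} (p : Fin N → Pbar A) : Fin N → Pbar A :=
  fun j => pneg (p j)

/-- Coordinatewise extended strictness order on tuples. -/
def leT {A : Type*} {N : ℕ} (s t : Fin N → Pbar A) : Prop :=
  ∀ j, barLE (s j) (t j)

/-- `p ∗ q := Ω_i(p, w(q))` in the Self-Reference System `(w, Ω_i)`. -/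
noncomputable def starOmega {A : Type*} {N : ℕ} (w : (Fin N → Pbar A) → Pbar A) (i : Fin N)
    (p q : Fin N → Pbar A) : Fin N → Pbar A :=
  Omega i p (w q)

/-- Two tuples are consistent (`s ⋈ t`) iff `s_j ⊓ t_j ≠ 𝐜` in every coordinate. -/
def Consistent {A : Type*} {N : ℕ} (s t : Fin N → Pbar A) : Prop :=
  ∀ j, pinf (s j) (t j) ≠ none

/-- `(Υ, d)` satisfies quasi-consistency in `(w, Ω_i)`: `d ≤ ¬(Υ ∗ ¬d)`. -/
noncomputable def QuasiConsistent {A : Type*} {N : ℕ} (w : (Fin N → Pbar A) → Pbar A)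
    (i : Fin N) (Υ d : Fin N → Pbar A) : Prop :=
  leT d (negT (starOmega w i Υ (negT d)))

/-- `d` is a quasi-Gödel sentence w.r.t. `Υ` in `(w, Ω_i)`: `d ≤ ¬(Υ ∗ d)`. -/
noncomputable def QuasiGodelSentence {A : Type*} {N : ℕ} (w : (Fin N → Pbar A) → Pbar A)
    (i : Fin N) (Υ d : Fin N → Pbar A) : Prop :=
  leT d (negT (starOmega w i Υ d))

/-- `(Υ, d)` satisfies quasi-completeness in `(w, Ω_i)`:
`¬(Υ ∗ d)` and `¬(Υ ∗ ¬d)` are inconsistent. -/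
noncomputable def QuasiComplete {A : Type*} {N : ℕ} (w : (Fin N → Pbar A) → Pbar A)
    (i : Fin N) (Υ d : Fin N → Pbar A) : Prop :=
  ¬ Consistent (negT (starOmega w i Υ d)) (negT (starOmega w i Υ (negT d)))

/-- `(w, Ω_i)` is a quasi-Gödelian system with respect to `Υ`. -/
noncomputable def QuasiGodelian {A : Type*} {N : ℕ} (w : (Fin N → Pbar A) → Pbar A)
    (i : Fin N) (Υ : Fin N → Pbar A) : Prop :=
  ∃ d : Fin N → WeakOrder A,
    QuasiGodelSentence w i Υ (coeP d) ∧
    ¬ (QuasiConsistent w i Υ (coeP d) ∧ QuasiComplete w i Υ (coeP d))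

/-- `a ≺ b` in `x ∈ P̄` (`𝐜` is regarded as containing every strict preference). -/
def strictIn {A : Type*} (x : Pbar A) (a b : A) : Prop :=
  match x with
  | none => True
  | some r => r.strict a b

/-- Unanimity for an extended Social Welfare Function. -/
def Unanimity {A : Type*} {N : ℕ} (w : (Fin N → Pbar A) → Pbar A) : Prop :=
  ∀ (p : Fin N → WeakOrder A) (a b : A),
    (∀ j, (p j).strict a b) → strictIn (w (coeP p)) a b

/-- Independence of Irrelevant Alternatives for an extended Social Welfare Function. -/
def IIA {A : Type*} {N : ℕ} (w : (Fin N → Pbar A) → Pbar A) : Prop :=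
  ∀ (p q : Fin N → WeakOrder A) (a b : A),
    (∀ j, ((p j).strict a b ↔ (q j).strict a b) ∧ ((p j).strict b a ↔ (q j).strict b a)) →
    ((strictIn (w (coeP p)) a b ↔ strictIn (w (coeP q)) a b) ∧
     (strictIn (w (coeP p)) b a ↔ strictIn (w (coeP q)) b a))

theorem WeakOrder.rel_iff_not_strict {A : Type*} (r : WeakOrder A) (a b : A) :
    r.rel a b ↔ ¬ r.strict b a := by
  have := r.total a b
  unfold WeakOrder.strict
  tauto

theorem strLE_antisymm {A : Type*} {r s : WeakOrder A} (hrs : strLE r s) (hsr : strLE s r) :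
    r = s := by
  have h : r.rel = s.rel := by
    funext a b
    rw [eq_iff_iff, r.rel_iff_not_strict, s.rel_iff_not_strict]
    exact not_congr ⟨hsr b a, hrs b a⟩
  cases r
  cases s
  cases h
  rfl

theorem barLE_refl {A : Type*} (x : Pbar A) : barLE x x := by
  cases x with
  | none => trivial
  | some r => exact fun _ _ h => h

theorem barLE_antisymm {A : Type*} {x y : Pbar A} (hxy : barLE x y) (hyx : barLE y x) :
    x = y := by
  cases x <;> cases y
  · rfl
  · exact hyx.elim
  · exact hxy.elim
  · exact congrArg some (strLE_antisymm hxy hyx)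

theorem barLE_indiff {A : Type*} (x : Pbar A) : barLE x (some (indiff A)) := by
  cases x with
  | none => trivial
  | some r => exact fun _ _ h => (h.2 trivial).elim

theorem IsGLBbar.unique {A : Type*} {x y s t : Pbar A} (hs : IsGLBbar x y s)
    (ht : IsGLBbar x y t) : s = t :=
  barLE_antisymm (ht.2.2 s hs.1 hs.2.1) (hs.2.2 t ht.1 ht.2.1)

theorem IsGLBbar.pinf_eq {A : Type*} {x y t : Pbar A} (ht : IsGLBbar x y t) :
    pinf x y = t := by
  have h : ∃ t, IsGLBbar x y t := ⟨t, ht⟩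
  rw [pinf, dif_pos h]
  exact h.choose_spec.unique ht

theorem pinf_eq_right {A : Type*} {x y : Pbar A} (h : barLE y x) : pinf x y = y :=
  IsGLBbar.pinf_eq ⟨h, barLE_refl y, fun _ _ hu => hu⟩

/-- If `w` has a dictator at `i`, then in the Self-Reference
System `(w, Ω_i)` the `i`-th indicator `Υ_i` is a diagonaliser restricted to
`P^N`: `Υ_i ∗ p = p ∗ p` for every `p ∈ P^N`. -/
theorem dictator_indicator_diagonaliser {A : Type*} {N : ℕ}
    (w : (Fin N → Pbar A) → Pbar A) (i : Fin N) (hd : HasDictatorAt w i) :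
    ∀ p : Fin N → WeakOrder A,
      starOmega w i (indicator i) (coeP p) = starOmega w i (coeP p) (coeP p) := by
  intro p
  have key : pinf (indicator i i) (w (coeP p)) = pinf (coeP p i) (w (coeP p)) := by
    rw [indicator, if_pos rfl]
    by_cases hp : p i = indiff A
    · rw [← hp, coeP]
    · rw [pinf_eq_right (barLE_indiff _)]
      exact (pinf_eq_right ((hd p).2 hp)).symm
  unfold starOmega Omega
  rw [key]
end

section
/- The extended strictness order (P̄, ≤) is a lattice (every pair of elements has a least upper bound ⊔ and a greatest lower bound ⊓), and the negation map ¬ is a complementation satisfying, for every r ∈ P̄: ¬¬r = r, r ⊓ ¬r = 𝐜, and r ⊔ ¬r = 𝐢. -/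
namespace WeakOrder

variable {A : Type*}

theorem ext_rel {r s : WeakOrder A} (h : ∀ a b, r.rel a b ↔ s.rel a b) : r = s := by
  cases r
  cases s
  congr 1
  funext a b
  exact propext (h a b)

theorem strict_iff_not_rel (r : WeakOrder A) (a b : A) : r.strict a b ↔ ¬ r.rel b a :=
  ⟨And.right, fun h => ⟨(r.total a b).resolve_right h, h⟩⟩

theorem strLE_iff_rel_imp {r s : WeakOrder A} :
    strLE r s ↔ ∀ a b, r.rel a b → s.rel a b := by
  simp only [strLE, strict_iff_not_rel, not_imp_not]
  exact forall_comm

theorem eq_indiff_iff {r : WeakOrder A} : r = indiff A ↔ ∀ a b, r.rel a b :=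
  ⟨fun h _ _ => h ▸ trivial, fun h => ext_rel fun a b => iff_of_true (h a b) trivial⟩

theorem reverse_eq_indiff_iff {r : WeakOrder A} : r.reverse = indiff A ↔ r = indiff A := by
  rw [eq_indiff_iff, eq_indiff_iff]
  exact forall_comm

/-- The transitive closure of the union of two weak orders. -/
def unionClosure (r s : WeakOrder A) : WeakOrder A where
  rel := Relation.TransGen fun a b => r.rel a b ∨ s.rel a b
  trans _ _ _ := Relation.TransGen.trans
  total a b := (r.total a b).imp (fun h => .single (.inl h)) fun h => .single (.inl h)

theorem isLUBw_unionClosure (r s : WeakOrder A) : IsLUBw r s (unionClosure r s) := by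
  simp only [IsLUBw, strLE_iff_rel_imp]
  refine ⟨fun _ _ h => .single (.inl h), fun _ _ h => .single (.inr h), fun u hr hs a b h => ?_⟩
  induction h with
  | single h => exact h.elim (hr _ _) (hs _ _)
  | tail _ h ih => exact u.trans _ _ _ ih (h.elim (hr _ _) (hs _ _))

/-- The intersection of two weak orders, when it is complete. -/
def inter (r s : WeakOrder A)
    (h : ∀ a b, (r.rel a b ∧ s.rel a b) ∨ (r.rel b a ∧ s.rel b a)) : WeakOrder A where
  rel a b := r.rel a b ∧ s.rel a b
  trans a b c h₁ h₂ := ⟨r.trans a b c h₁.1 h₂.1, s.trans a b c h₁.2 h₂.2⟩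
  total := h

theorem isGLBw_inter (r s : WeakOrder A)
    (h : ∀ a b, (r.rel a b ∧ s.rel a b) ∨ (r.rel b a ∧ s.rel b a)) :
    IsGLBw r s (inter r s h) := by
  simp only [IsGLBw, strLE_iff_rel_imp]
  exact ⟨fun _ _ h => h.1, fun _ _ h => h.2, fun _ hr hs a b h => ⟨hr a b h, hs a b h⟩⟩

theorem inter_complete_of_strLE {r s u : WeakOrder A} (hr : strLE u r) (hs : strLE u s)
    (a b : A) : (r.rel a b ∧ s.rel a b) ∨ (r.rel b a ∧ s.rel b a) := by
  rw [strLE_iff_rel_imp] at hr hs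
  exact (u.total a b).imp (fun h => ⟨hr _ _ h, hs _ _ h⟩) fun h => ⟨hr _ _ h, hs _ _ h⟩

theorem eq_indiff_of_strLE_reverse {r u : WeakOrder A} (h : strLE u r)
    (h' : strLE u r.reverse) : r = indiff A :=
  eq_indiff_iff.2 fun a b => (inter_complete_of_strLE h h' a b).elim And.left And.right

end WeakOrder

section Pbar

variable {A : Type*}

theorem barLE_refl_s16 : ∀ r : Pbar A, barLE r r
  | none => trivial
  | some _ => fun _ _ h => h

theorem barLE_none (r : Pbar A) : barLE none r := trivial

theorem IsLUBbar.symm {r s t : Pbar A} (h : IsLUBbar r s t) : IsLUBbar s r t :=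
  ⟨h.2.1, h.1, fun u hs hr => h.2.2 u hr hs⟩

theorem IsGLBbar.symm {r s t : Pbar A} (h : IsGLBbar r s t) : IsGLBbar s r t :=
  ⟨h.2.1, h.1, fun u hs hr => h.2.2 u hr hs⟩

theorem isLUBbar_none_left (s : Pbar A) : IsLUBbar none s s :=
  ⟨barLE_none s, barLE_refl_s16 s, fun _ _ h => h⟩

theorem isGLBbar_none_left (s : Pbar A) : IsGLBbar none s none :=
  ⟨barLE_none none, barLE_none s, fun _ h _ => h⟩

theorem isLUBbar_some {r s t : WeakOrder A} (h : IsLUBw r s t) :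
    IsLUBbar (some r) (some s) (some t) := by
  refine ⟨h.1, h.2.1, fun u hr hs => ?_⟩
  cases u with
  | none => exact hr
  | some u => exact h.2.2 u hr hs

theorem isGLBbar_some {r s t : WeakOrder A} (h : IsGLBw r s t) :
    IsGLBbar (some r) (some s) (some t) := by
  refine ⟨h.1, h.2.1, fun u hr hs => ?_⟩
  cases u with
  | none => trivial
  | some u => exact h.2.2 u hr hs

theorem isGLBbar_some_none {r s : WeakOrder A} (h : ∀ u, strLE u r → ¬ strLE u s) :
    IsGLBbar (some r) (some s) none := by
  refine ⟨trivial, trivial, fun u hr hs => ?_⟩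
  cases u with
  | none => trivial
  | some u => exact h u hr hs

theorem exists_isLUBbar : ∀ r s : Pbar A, ∃ t, IsLUBbar r s t
  | none, s => ⟨s, isLUBbar_none_left s⟩
  | some r, none => ⟨some r, (isLUBbar_none_left _).symm⟩
  | some r, some s => ⟨_, isLUBbar_some (r.isLUBw_unionClosure s)⟩

theorem exists_isGLBbar : ∀ r s : Pbar A, ∃ t, IsGLBbar r s t
  | none, s => ⟨none, isGLBbar_none_left s⟩
  | some r, none => ⟨none, (isGLBbar_none_left _).symm⟩
  | some r, some s => by
    by_cases h : ∀ a b, (r.rel a b ∧ s.rel a b) ∨ (r.rel b a ∧ s.rel b a)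
    · exact ⟨_, isGLBbar_some (r.isGLBw_inter s h)⟩
    · exact ⟨none, isGLBbar_some_none fun _ hr hs => h (WeakOrder.inter_complete_of_strLE hr hs)⟩

theorem pneg_none : pneg (none : Pbar A) = some (indiff A) := rfl

theorem pneg_indiff : pneg (some (indiff A)) = none := if_pos rfl

theorem pneg_some {r : WeakOrder A} (h : r ≠ indiff A) : pneg (some r) = some r.reverse :=
  if_neg h

theorem pneg_pneg (r : Pbar A) : pneg (pneg r) = r := by
  cases r with
  | none => rw [pneg_none, pneg_indiff]
  | some r =>
    by_cases h : r = indiff A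
    · rw [h, pneg_indiff, pneg_none]
    · rw [pneg_some h, pneg_some (mt WeakOrder.reverse_eq_indiff_iff.1 h)]
      rfl

theorem isGLBbar_pneg (r : Pbar A) : IsGLBbar r (pneg r) none := by
  cases r with
  | none => exact isGLBbar_none_left _
  | some r =>
    by_cases h : r = indiff A
    · rw [h, pneg_indiff]
      exact (isGLBbar_none_left _).symm
    · rw [pneg_some h]
      exact isGLBbar_some_none fun _ hu hu' => h (WeakOrder.eq_indiff_of_strLE_reverse hu hu')

theorem isLUBw_reverse (r : WeakOrder A) : IsLUBw r r.reverse (indiff A) := by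
  simp only [IsLUBw, WeakOrder.strLE_iff_rel_imp]
  exact ⟨fun _ _ _ => trivial, fun _ _ _ => trivial,
    fun _ h h' a b _ => (r.total a b).elim (h a b) (h' a b)⟩

theorem isLUBbar_pneg (r : Pbar A) : IsLUBbar r (pneg r) (some (indiff A)) := by
  cases r with
  | none => exact isLUBbar_none_left _
  | some r =>
    by_cases h : r = indiff A
    · rw [h, pneg_indiff]
      exact (isLUBbar_none_left _).symm
    · rw [pneg_some h]
      exact isLUBbar_some (isLUBw_reverse r)

end Pbar

/-- The extended strictness order `(P̄, ≤)` is a lattice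
(every pair has a least upper bound and a greatest lower bound), and negation
is a complementation: `¬¬r = r`, `r ⊓ ¬r = 𝐜` and `r ⊔ ¬r = 𝐢`. -/
theorem pbar_lattice_complemented {A : Type*} :
    (∀ r s : Pbar A, (∃ t : Pbar A, IsLUBbar r s t) ∧ (∃ t : Pbar A, IsGLBbar r s t)) ∧
    (∀ r : Pbar A,
      pneg (pneg r) = r ∧
      IsGLBbar r (pneg r) (none : Pbar A) ∧
      IsLUBbar r (pneg r) (some (indiff A))) := by
  exact ⟨fun r s => ⟨exists_isLUBbar r s, exists_isGLBbar r s⟩,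
    fun r => ⟨pneg_pneg r, isGLBbar_pneg r, isLUBbar_pneg r⟩⟩
end
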